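/- Let Y₁, ..., Yₙ be a sequence of martingale increments (i.e. E[Y_k | Y₁,...,Y_{k−1}] = 0) with E[|Y_k|^{1+ε}] < ∞, and fix ε ∈ [0,1]. Then there exists a universal constant c > 0 such that E[|Σ_{k=1}^n Y_k|^{1+ε}] ≤ c Σ_{k=1}^n E[|Y_k|^{1+ε}]. -/

import Mathlib

open MeasureTheory Finset

/-- Signed power. -/
noncomputable def vbeS (ε x : ℝ) : ℝ :=
  if 0 < x then x ^ ε else if x < 0 then -((-x) ^ ε) else 0

lemma vbeS_measurable (ε : ℝ) : Measurable (vbeS ε) := by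
  unfold vbeS
  refine Measurable.ite measurableSet_Ioi (by fun_prop) ?_
  exact Measurable.ite measurableSet_Iio (by fun_prop) (by fun_prop)

lemma vbeS_abs_le (ε x : ℝ) : |vbeS ε x| ≤ |x| ^ ε := by
  unfold vbeS
  split_ifs with h1 h2
  · rw [abs_of_pos h1, abs_of_nonneg (Real.rpow_nonneg h1.le _)]
  · rw [abs_neg, abs_of_neg h2, abs_of_nonneg (Real.rpow_nonneg (by linarith) _)]
  · simpa using Real.rpow_nonneg (abs_nonneg x) ε

lemma vbeS_mul_self (ε x : ℝ) (h0 : 0 ≤ ε) : vbeS ε x * x = |x| ^ (1 + ε) := by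
  unfold vbeS
  split_ifs with h1 h2
  · rw [abs_of_pos h1, Real.rpow_add h1, Real.rpow_one, mul_comm]
  · rw [abs_of_neg h2, Real.rpow_add (by linarith), Real.rpow_one]; ring
  · have : x = 0 := by linarith
    subst this
    rw [abs_zero, Real.zero_rpow (by linarith), mul_zero]

lemma vbe_young (ε a b : ℝ) (h0 : 0 ≤ ε) (ha : 0 ≤ a) (hb : 0 ≤ b) :
    (1 + ε) * (a ^ ε * b) ≤ b ^ (1 + ε) + ε * a ^ (1 + ε) := by
  have hp : 0 < 1 + ε := by linarith
  have := Real.geom_mean_le_arith_mean2_weighted (w₁ := ε / (1 + ε)) (w₂ := 1 / (1 + ε))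
    (p₁ := a ^ (1 + ε)) (p₂ := b ^ (1 + ε)) (by positivity) (by positivity)
    (by positivity) (by positivity) (by field_simp; ring)
  rw [← Real.rpow_mul ha, ← Real.rpow_mul hb, mul_div_cancel₀ _ hp.ne',
    mul_div_cancel₀ _ hp.ne', Real.rpow_one] at this
  calc (1 + ε) * (a ^ ε * b) ≤ (1 + ε) * _ := mul_le_mul_of_nonneg_left this hp.le
    _ = _ := by field_simp; ring

lemma vbe_holder_pos (ε a b : ℝ) (h0 : 0 ≤ ε) (h1 : ε ≤ 1) (ha : 0 ≤ a) (hb : 0 ≤ b) :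
    a ^ ε - b ^ ε ≤ |a - b| ^ ε := by
  have h2 : a ^ ε ≤ (b + |a - b|) ^ ε :=
    Real.rpow_le_rpow ha (by linarith [le_abs_self (a - b)]) h0
  have := Real.rpow_add_le_add_rpow hb (abs_nonneg (a - b)) h0 h1
  linarith

lemma vbe_holder (ε a b : ℝ) (h0 : 0 ≤ ε) (h1 : ε ≤ 1) :
    vbeS ε a - vbeS ε b ≤ 2 * |a - b| ^ ε := by
  have hn := Real.rpow_nonneg (abs_nonneg (a - b)) ε
  have hm : ∀ x, 0 ≤ x → x ≤ |a - b| → x ^ ε ≤ |a - b| ^ ε :=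
    fun x hx hxy => Real.rpow_le_rpow hx hxy h0
  have hl := le_abs_self (a - b)
  unfold vbeS
  split_ifs with c1 c2 c3 c4 c5 c6 c7 c8
  · linarith [vbe_holder_pos ε a b h0 h1 c1.le c2.le]
  · linarith [hm a c1.le (by linarith), hm (-b) (by linarith) (by linarith)]
  · linarith [hm a c1.le (by linarith)]
  · linarith [Real.rpow_nonneg (show 0 ≤ -a by linarith) ε, Real.rpow_nonneg c5.le ε]
  · have := vbe_holder_pos ε (-b) (-a) h0 h1 (by linarith) (by linarith)
    rw [show -b - -a = a - b by ring] at this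
    linarith
  · linarith [Real.rpow_nonneg (show 0 ≤ -a by linarith) ε]
  · linarith [Real.rpow_nonneg c7.le ε]
  · linarith [hm (-b) (by linarith) (by linarith)]
  · linarith

lemma vbe_mul_le (ε a b : ℝ) (h0 : 0 ≤ ε) :
    (1 + ε) * |vbeS ε a * b| ≤ |b| ^ (1 + ε) + ε * |a| ^ (1 + ε) := by
  refine le_trans ?_ (vbe_young ε |a| |b| h0 (abs_nonneg a) (abs_nonneg b))
  rw [abs_mul]
  have := vbeS_abs_le ε a
  gcongr

lemma vbe_point (ε x y : ℝ) (h0 : 0 ≤ ε) (h1 : ε ≤ 1) :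
    |x + y| ^ (1 + ε) ≤ |x| ^ (1 + ε) + (1 + ε) * (vbeS ε x * y) + 4 * |y| ^ (1 + ε) := by
  have t1 := vbe_mul_le ε (x + y) x h0
  have t2 := vbeS_mul_self ε (x + y) h0
  have t3 : vbeS ε (x + y) * x ≤ |vbeS ε (x + y) * x| := le_abs_self _
  have t4 : (1 + ε) * (vbeS ε (x + y) * x) ≤ (1 + ε) * |vbeS ε (x + y) * x| := by gcongr
  have hy : |y| ^ (1 + ε) = |y| ^ ε * |y| := by
    rw [add_comm, Real.rpow_add_one' (abs_nonneg y) (by linarith)]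
  have k1 := vbe_holder ε (x + y) x h0 h1
  have k2 := vbe_holder ε x (x + y) h0 h1
  rw [show x + y - x = y by ring] at k1
  rw [show x - (x + y) = -y by ring, abs_neg] at k2
  have t5 : (vbeS ε (x + y) - vbeS ε x) * y ≤ 2 * |y| ^ (1 + ε) := by
    rw [hy]
    calc _ ≤ |(vbeS ε (x + y) - vbeS ε x) * y| := le_abs_self _
      _ = |vbeS ε (x + y) - vbeS ε x| * |y| := abs_mul _ _
      _ ≤ (2 * |y| ^ ε) * |y| := by
        gcongr
        exact abs_le.2 ⟨by linarith, k1⟩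
      _ = _ := by ring
  have hn : 0 ≤ |y| ^ (1 + ε) := by positivity
  have t6 : (1 + ε) * ((vbeS ε (x + y) - vbeS ε x) * y) ≤ (1 + ε) * (2 * |y| ^ (1 + ε)) := by
    gcongr
  have t7 : (1 + ε) * (2 * |y| ^ (1 + ε)) ≤ 4 * |y| ^ (1 + ε) := by nlinarith
  have t8 : (1 + ε) * (vbeS ε (x + y) * (x + y)) = (1 + ε) * |x + y| ^ (1 + ε) := by rw [t2]
  linarith

lemma vbe_step {Ω : Type} {m' m : MeasurableSpace Ω} (μ : Measure Ω) [IsProbabilityMeasure μ]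
    (hm : m' ≤ m) (ε : ℝ) (h0 : 0 ≤ ε) (h1 : ε ≤ 1) (S Y : Ω → ℝ)
    (hS : StronglyMeasurable[m'] S) (hSi : Integrable (fun ω => |S ω| ^ (1 + ε)) μ)
    (hY : Integrable Y μ) (hYi : Integrable (fun ω => |Y ω| ^ (1 + ε)) μ)
    (hc : μ[Y | m'] =ᵐ[μ] 0) :
    Integrable (fun ω => |S ω + Y ω| ^ (1 + ε)) μ ∧
    ∫ ω, |S ω + Y ω| ^ (1 + ε) ∂μ ≤
      ∫ ω, |S ω| ^ (1 + ε) ∂μ + 4 * ∫ ω, |Y ω| ^ (1 + ε) ∂μ := by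
  have hs : StronglyMeasurable[m'] (fun ω => vbeS ε (S ω)) :=
    ((vbeS_measurable ε).comp hS.measurable).stronglyMeasurable
  have hSm := (hS.mono hm).aestronglyMeasurable (μ := μ)
  have hprod : Integrable (fun ω => vbeS ε (S ω) * Y ω) μ := by
    refine (hYi.add (hSi.const_mul ε)).mono'
      ((hs.mono hm).aestronglyMeasurable.mul hY.aestronglyMeasurable) ?_
    filter_upwards with ω
    have := vbe_mul_le ε (S ω) (Y ω) h0
    have h2 := mul_nonneg h0 (abs_nonneg (vbeS ε (S ω) * Y ω))
    simp only [Real.norm_eq_abs, Pi.add_apply]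
    linarith
  have hz : ∫ ω, vbeS ε (S ω) * Y ω ∂μ = 0 := by
    have e := condExp_mul_of_stronglyMeasurable_left (μ := μ) hs hprod hY
    rw [← integral_condExp hm]
    refine integral_eq_zero_of_ae ?_
    filter_upwards [e, hc] with ω e1 e2
    refine Eq.trans e1 ?_
    simp [e2]
  have hA : Integrable (fun ω => |S ω| ^ (1 + ε) + (1 + ε) * (vbeS ε (S ω) * Y ω)) μ :=
    hSi.add (hprod.const_mul _)
  have hB : Integrable (fun ω => |S ω| ^ (1 + ε) + (1 + ε) * (vbeS ε (S ω) * Y ω)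
      + 4 * |Y ω| ^ (1 + ε)) μ := hA.add (hYi.const_mul 4)
  have hI : Integrable (fun ω => |S ω + Y ω| ^ (1 + ε)) μ := by
    refine hB.mono' ?_ ?_
    · exact ((hSm.add hY.aestronglyMeasurable).aemeasurable.abs.pow_const _).aestronglyMeasurable
    · filter_upwards with ω
      rw [Real.norm_eq_abs, abs_of_nonneg (by positivity)]
      exact vbe_point ε _ _ h0 h1
  refine ⟨hI, ?_⟩
  calc _ ≤ _ := integral_mono hI hB (fun ω => vbe_point ε _ _ h0 h1)
    _ = _ := by
      rw [integral_add hA (hYi.const_mul 4), integral_add hSi (hprod.const_mul _),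
        integral_const_mul, integral_const_mul, hz]
      ring

/-- Von Bahr–Esseen inequality for martingale difference sequences: for each
`ε ∈ [0,1]` there is a universal constant `c > 0` such that for any martingale
increments `Y 1, ..., Y n` (i.e. `E[Y k | ℱ (k-1)] = 0` with `Y k` `ℱ k`-measurable)
with `E[|Y k|^{1+ε}] < ∞`, one has
`E[|∑ Y k|^{1+ε}] ≤ c * ∑ E[|Y k|^{1+ε}]`. -/
theorem vonBahr_Esseen_martingale_differences (ε : ℝ) (hε0 : 0 ≤ ε) (hε1 : ε ≤ 1) :
    ∃ c : ℝ, 0 < c ∧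
      ∀ (Ω : Type) (m : MeasurableSpace Ω) (μ : Measure Ω),
        IsProbabilityMeasure μ →
        ∀ (n : ℕ) (Y : ℕ → Ω → ℝ) (ℱ : Filtration ℕ m),
          (∀ k, 1 ≤ k → k ≤ n → StronglyMeasurable[ℱ k] (Y k)) →
          (∀ k, 1 ≤ k → k ≤ n → Integrable (Y k) μ) →
          (∀ k, 1 ≤ k → k ≤ n → Integrable (fun ω => |Y k ω| ^ (1 + ε)) μ) →
          (∀ k, 1 ≤ k → k ≤ n → μ[Y k | ℱ (k - 1)] =ᵐ[μ] 0) →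
          (∫ ω, |∑ k ∈ Finset.Icc 1 n, Y k ω| ^ (1 + ε) ∂μ) ≤
            c * ∑ k ∈ Finset.Icc 1 n, ∫ ω, |Y k ω| ^ (1 + ε) ∂μ := by
  refine ⟨4, by norm_num, ?_⟩
  intro Ω m μ hμ n Y ℱ hY hYi hYp hc
  have key : ∀ j, j ≤ n →
      StronglyMeasurable[ℱ j] (fun ω => ∑ k ∈ Finset.Icc 1 j, Y k ω) ∧
      Integrable (fun ω => |∑ k ∈ Finset.Icc 1 j, Y k ω| ^ (1 + ε)) μ ∧
      (∫ ω, |∑ k ∈ Finset.Icc 1 j, Y k ω| ^ (1 + ε) ∂μ) ≤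
        4 * ∑ k ∈ Finset.Icc 1 j, ∫ ω, |Y k ω| ^ (1 + ε) ∂μ := by
    intro j
    induction j with
    | zero =>
      intro _
      have hp : (1 + ε) ≠ 0 := by linarith
      simp [Real.zero_rpow hp, stronglyMeasurable_const]
    | succ j ih =>
      intro hj
      obtain ⟨i1, i2, i3⟩ := ih (by omega)
      have h1 : 1 ≤ j + 1 := by omega
      have hcj := hc (j + 1) h1 hj
      rw [Nat.add_sub_cancel] at hcj
      obtain ⟨s1, s2⟩ := vbe_step μ (ℱ.le j) ε hε0 hε1 _ _ i1 i2 (hYi _ h1 hj) (hYp _ h1 hj) hcj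
      simp only [Finset.sum_Icc_succ_top h1]
      refine ⟨(i1.mono (ℱ.mono (Nat.le_succ j))).add (hY _ h1 hj), s1, ?_⟩
      linarith
  exact (key n le_rfl).2.2
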